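/- arXiv:1311.0224 — 10 statements merged into one kernel-verified Lean document; each statement's English description precedes it below -/
import Mathlib

section
/- For every finite simple graph G and every set X ⊆ E(G) of edges, cutrk^ℚ_G(T_X) ≤ η_G(X), where T_X is the set of vertices incident with an edge of X and η_G(X) is the number of vertices incident both with an edge of X and with an edge of E(G)∖X. -/
open scoped Classical

noncomputable def cutRank (F : Type) [Field F] {V : Type} [Fintype V]
    (G : SimpleGraph V) (A : Set V) : ℕ :=
  (Matrix.of (fun (u : A) (v : ↥Aᶜ) => if G.Adj u.1 v.1 then (1 : F) else 0)).rank

/-- `incVerts X` is the set `T_X` of vertices incident with at least one edge of `X`. -/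
def incVerts {V : Type} (X : Set (Sym2 V)) : Set V := { v | ∃ e ∈ X, v ∈ e }

/-- `eta G X = |T_X ∩ T_{E(G) \ X}|`. -/
noncomputable def eta {V : Type} [Fintype V] (G : SimpleGraph V) (X : Set (Sym2 V)) : ℕ :=
  (incVerts X ∩ incVerts (G.edgeSet \ X)).ncard

/-- An edge leaving `incVerts X` starts at a vertex incident with an edge outside `X`. -/
theorem mem_incVerts_diff_of_adj {V : Type} {G : SimpleGraph V} {X : Set (Sym2 V)} {u v : V}
    (hv : v ∉ incVerts X) (h : G.Adj u v) : u ∈ incVerts (G.edgeSet \ X) :=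
  ⟨s(u, v), ⟨h, fun hX => hv ⟨_, hX, Sym2.mem_mk_right u v⟩⟩, Sym2.mem_mk_left u v⟩

theorem stmt2 {V : Type} [Fintype V] (G : SimpleGraph V) (X : Set (Sym2 V))
    (hX : X ⊆ G.edgeSet) :
    cutRank ℚ G (incVerts X) ≤ eta G X := by
  let s : Finset (incVerts X) := {u | u.1 ∈ incVerts (G.edgeSet \ X)}
  have hs : s.card = eta G X := by
    rw [eta, ← Subtype.image_preimage_coe,
      Set.ncard_image_of_injective _ Subtype.val_injective, ← Set.ncard_coe_finset]
    congr 1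
    ext u
    simp [s]
  rw [← hs, cutRank]
  refine Matrix.rank_le_card_of_support_subset _ s fun u hu => ?_
  obtain ⟨v, hv⟩ := Function.ne_iff.mp hu
  have h : G.Adj u.1 v.1 := by simpa using hv
  simpa [s] using mem_incVerts_diff_of_adj v.2 h
end

section
/- Let k ≥ 2 be an integer and let G be a connected finite simple graph. If 𝒯 is a cutrk^ℚ_G-tangle of order k+1 on V(G), then the family 𝒰 = { X ⊆ E(G) : η_G(X) ≤ k and T_X ∈ 𝒯 } is an η_G-tangle of order k+1 on E(G). -/
open scoped Classical

/-- `η_G` as a set function on the ground set `E(G)`, viewed as a subtype. -/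
noncomputable def etaE {V : Type} [Fintype V] (G : SimpleGraph V)
    (X : Set ↥G.edgeSet) : ℕ :=
  eta G (Subtype.val '' X)

/-- `IsTangle f k 𝒯` : `𝒯` is an `f`-tangle of order `k + 1` on the ground set `α`. -/
structure IsTangle {α : Type} (f : Set α → ℕ) (k : ℕ) (𝒯 : Set (Set α)) : Prop where
  t1 : ∀ A : Set α, f A ≤ k → A ∈ 𝒯 ∨ Aᶜ ∈ 𝒯
  t2 : ∀ A B C : Set α, A ∈ 𝒯 → B ∈ 𝒯 → C ∈ 𝒯 → A ∪ B ∪ C ≠ Set.univ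
  t3 : ∀ v : α, ({v}ᶜ : Set α) ∉ 𝒯

/-- If every edge leaving `A` starts in `S`, then the cut-rank of `A` is at most `|S|`. -/
theorem cutRank_le_ncard (F : Type) [Field F] {V : Type} [Fintype V] (G : SimpleGraph V)
    (A S : Set V) (h : ∀ u ∈ A, ∀ v ∉ A, G.Adj u v → u ∈ S) :
    cutRank F G A ≤ S.ncard := by
  let row : V → ↥Aᶜ → F := fun u v => if G.Adj u v.1 then 1 else 0
  have hle : Submodule.span F (Set.range (Matrix.of
      (fun (u : A) (v : ↥Aᶜ) => if G.Adj u.1 v.1 then (1 : F) else 0)).row) ≤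
      Submodule.span F (row '' S) := by
    rw [Submodule.span_le]
    rintro _ ⟨u, rfl⟩
    by_cases hu : u.1 ∈ S
    · exact Submodule.subset_span ⟨u.1, hu, rfl⟩
    · have hzero : row u.1 = 0 :=
        funext fun v => if_neg fun hadj => hu (h u.1 u.2 v.1 v.2 hadj)
      change row u.1 ∈ Submodule.span F (row '' S)
      exact hzero ▸ Submodule.zero_mem _
  unfold cutRank
  rw [Matrix.rank_eq_finrank_span_row]
  calc _ ≤ Module.finrank F (Submodule.span F (row '' S)) := Submodule.finrank_mono hle
    _ ≤ (row '' S).toFinset.card := finrank_span_le_card _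
    _ = (row '' S).ncard := (Set.ncard_eq_toFinset_card' _).symm
    _ ≤ S.ncard := Set.ncard_image_le

namespace IsTangle

variable {α : Type} {f : Set α → ℕ} {k : ℕ} {𝒯 : Set (Set α)}

theorem empty_mem (h : IsTangle f k 𝒯) (h0 : f ∅ ≤ k) : ∅ ∈ 𝒯 := by
  refine (h.t1 ∅ h0).resolve_right fun hu => h.t2 _ _ _ hu hu hu ?_
  simp

theorem singleton_mem (h : IsTangle f k 𝒯) {v : α} (hv : f {v} ≤ k) : {v} ∈ 𝒯 :=
  (h.t1 _ hv).resolve_right (h.t3 v)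

/-- If `f` is bounded by cardinality, then a tangle of order `k + 1` contains all sets with at
most `k` elements. -/
theorem mem_of_ncard_le (h : IsTangle f k 𝒯) (hf : ∀ S : Set α, f S ≤ S.ncard) {S : Set α}
    (hfin : S.Finite) (hS : S.ncard ≤ k) : S ∈ 𝒯 := by
  induction S, hfin using Set.Finite.induction_on with
  | empty => exact h.empty_mem ((hf _).trans hS)
  | @insert v S hv hfin ih =>
    have hcard := Set.ncard_insert_of_notMem hv hfin
    refine (h.t1 _ ((hf _).trans hS)).resolve_right fun hc => ?_
    have hsing : {v} ∈ 𝒯 := h.singleton_mem ((hf _).trans (by rw [Set.ncard_singleton]; omega))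
    refine h.t2 _ _ _ (ih (by omega)) hsing hc ?_
    ext x
    simp only [Set.mem_union, Set.mem_singleton_iff, Set.mem_compl_iff, Set.mem_insert_iff,
      Set.mem_univ]
    tauto

/-- The ground set of a tangle whose function is small on `∅` is not a singleton. -/
theorem nontrivial [Nonempty α] (h : IsTangle f k 𝒯) (h0 : f ∅ ≤ k) : Nontrivial α := by
  by_contra hn
  rw [not_nontrivial_iff_subsingleton] at hn
  obtain ⟨v⟩ := ‹Nonempty α›
  refine h.t3 v ?_
  convert h.empty_mem h0
  ext x
  simp [Subsingleton.elim x v]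

end IsTangle

theorem cutRank_incVerts_le_eta (F : Type) [Field F] {V : Type} [Fintype V]
    (G : SimpleGraph V) (X : Set (Sym2 V)) : cutRank F G (incVerts X) ≤ eta G X := by
  refine cutRank_le_ncard F G _ _ fun u hu v hv hadj => ⟨hu, s(u, v), ⟨hadj, fun hX => ?_⟩, ?_⟩
  · exact hv ⟨_, hX, Sym2.mem_mk_right u v⟩
  · exact Sym2.mem_mk_left u v

theorem incVerts_union {V : Type} (X Y : Set (Sym2 V)) :
    incVerts (X ∪ Y) = incVerts X ∪ incVerts Y := by
  ext v
  simp only [incVerts, Set.mem_union, Set.mem_ofPred_eq, or_and_right, exists_or]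

theorem incVerts_edgeSet {V : Type} [Nontrivial V] {G : SimpleGraph V} (hG : G.Connected) :
    incVerts G.edgeSet = Set.univ := by
  refine Set.eq_univ_of_forall fun v => ?_
  obtain ⟨w, hw⟩ := hG.preconnected.exists_adj_of_nontrivial v
  exact ⟨s(v, w), hw, Sym2.mem_mk_left v w⟩

theorem image_val_compl_edgeSet {V : Type} (G : SimpleGraph V) (X : Set ↥G.edgeSet) :
    (Subtype.val '' Xᶜ : Set (Sym2 V)) = G.edgeSet \ Subtype.val '' X := by
  rw [Set.image_compl_eq_range_sdiff_image Subtype.val_injective, Subtype.range_coe]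

theorem etaE_compl {V : Type} [Fintype V] (G : SimpleGraph V) (X : Set ↥G.edgeSet) :
    etaE G Xᶜ = etaE G X := by
  unfold etaE eta
  rw [← image_val_compl_edgeSet, ← image_val_compl_edgeSet, compl_compl, Set.inter_comm]

theorem stmt4 {V : Type} [Fintype V] (G : SimpleGraph V) (hG : G.Connected)
    (k : ℕ) (hk : 2 ≤ k) (𝒯 : Set (Set V)) (h𝒯 : IsTangle (cutRank ℚ G) k 𝒯) :
    IsTangle (etaE G) k
      { X : Set ↥G.edgeSet | etaE G X ≤ k ∧ incVerts (Subtype.val '' X) ∈ 𝒯 } := by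
  have hcard (S : Set V) : cutRank ℚ G S ≤ S.ncard :=
    cutRank_le_ncard ℚ G S S fun u hu _ _ _ => hu
  have := hG.nonempty
  have := h𝒯.nontrivial ((hcard ∅).trans (by simp))
  have hcover (X : Set ↥G.edgeSet) :
      incVerts (Subtype.val '' X) ∪ incVerts (Subtype.val '' Xᶜ) = Set.univ := by
    rw [← incVerts_union, ← Set.image_union, Set.union_compl_self, Set.image_univ,
      Subtype.range_coe, incVerts_edgeSet hG]
  refine ⟨fun X hX => ?_, ?_, ?_⟩
  · have hX' : etaE G Xᶜ ≤ k := (etaE_compl G X).trans_le hX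
    by_contra! hn
    have hA := (h𝒯.t1 _ ((cutRank_incVerts_le_eta ℚ G _).trans hX)).resolve_left
      fun h => hn.1 ⟨hX, h⟩
    have hB := (h𝒯.t1 _ ((cutRank_incVerts_le_eta ℚ G _).trans hX')).resolve_left
      fun h => hn.2 ⟨hX', h⟩
    have hS : incVerts (Subtype.val '' X) ∩ incVerts (Subtype.val '' Xᶜ) ∈ 𝒯 := by
      refine h𝒯.mem_of_ncard_le hcard (Set.toFinite _) ?_
      rw [image_val_compl_edgeSet]
      exact hX
    refine h𝒯.t2 _ _ _ hA hB hS ?_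
    rw [← Set.compl_inter, Set.compl_union_self]
  · rintro X Y Z ⟨-, hX⟩ ⟨-, hY⟩ ⟨-, hZ⟩ hXYZ
    refine h𝒯.t2 _ _ _ hX hY hZ ?_
    rw [← incVerts_union, ← incVerts_union, ← Set.image_union, ← Set.image_union, hXYZ,
      Set.image_univ, Subtype.range_coe, incVerts_edgeSet hG]
  · rintro e ⟨-, he⟩
    have hsing (v : V) : {v} ∈ 𝒯 :=
      h𝒯.singleton_mem ((hcard _).trans (by rw [Set.ncard_singleton]; omega))
    obtain ⟨u, v, huv⟩ : ∃ u v, e.1 = s(u, v) := Sym2.ind (fun u v => ⟨u, v, rfl⟩) e.1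
    refine h𝒯.t2 _ _ _ he (hsing u) (hsing v) (Set.eq_univ_of_forall fun w => ?_)
    have hw := (hcover {e}ᶜ).ge (Set.mem_univ w)
    rw [compl_compl, Set.image_singleton, huv] at hw
    rcases hw with hw | ⟨_, rfl, hw⟩
    · exact Or.inl (Or.inl hw)
    · rcases Sym2.mem_iff.mp hw with rfl | rfl
      · exact Or.inl (Or.inr rfl)
      · exact Or.inr rfl
end

section
/- Let k ≥ 2 be an integer. If a finite simple graph G has ℚ-rank-width at least k+1, then G has branch-width at least k+1. -/
open scoped Classical

structure BranchDecomp (α : Type) [Fintype α] where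
  τ : Type
  [fin : Fintype τ]
  T : SimpleGraph τ
  isTree : T.IsTree
  deg : ∀ v : τ, T.degree v = 1 ∨ T.degree v = 3
  δ : {v : τ // T.degree v = 1} ≃ α

attribute [instance] BranchDecomp.fin

def BranchDecomp.side {α : Type} [Fintype α] (B : BranchDecomp α) (u v : B.τ) : Set α :=
  { x : α | (B.T.deleteEdges {s(u, v)}).Reachable u ((B.δ.symm x) : B.τ) }

noncomputable def BranchDecomp.width {α : Type} [Fintype α] (B : BranchDecomp α)
    (f : Set α → ℕ) : ℕ :=
  sSup { n | ∃ u v : B.τ, B.T.Adj u v ∧ f (B.side u v) = n }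

noncomputable def fWidth (α : Type) [Fintype α] (f : Set α → ℕ) : ℕ :=
  if Fintype.card α ≤ 1 then f ∅
  else sInf { n | ∃ B : BranchDecomp α, B.width f = n }

noncomputable def qRankWidth {V : Type} [Fintype V] (G : SimpleGraph V) : ℕ :=
  fWidth V (cutRank ℚ G)

/-- The branch-width of a graph: the `η_G`-width of its edge set. -/
noncomputable def graphBranchWidth {V : Type} [Fintype V] (G : SimpleGraph V) : ℕ :=
  fWidth ↥G.edgeSet (etaE G)

namespace SimpleGraph

variable {τ σ : Type}

/-- If `u`-`v` is the only edge of `T` leaving `S`, then reachability in `T - uv` respects `S`. -/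
lemma mem_iff_of_reachable_deleteEdges {T : SimpleGraph τ} {S : Set τ} {u v a b : τ}
    (hS : ∀ x y, T.Adj x y → x ∈ S → y ∉ S → s(x, y) = s(u, v))
    (h : (T.deleteEdges {s(u, v)}).Reachable a b) : a ∈ S ↔ b ∈ S := by
  obtain ⟨w⟩ := h
  induction w with
  | nil => rfl
  | @cons x y z hxy _ ih =>
    rw [← ih]
    rw [deleteEdges_adj] at hxy
    constructor
    · intro hx
      by_contra hy
      exact hxy.2 (hS x y hxy.1 hx hy)
    · intro hy
      by_contra hx
      exact hxy.2 (Sym2.eq_swap.trans (hS y x hxy.1.symm hy hx))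

lemma Connected.reachable_deleteEdges_or {T : SimpleGraph τ} (hT : T.Connected) (u v x : τ) :
    (T.deleteEdges {s(u, v)}).Reachable u x ∨ (T.deleteEdges {s(u, v)}).Reachable v x := by
  obtain ⟨w⟩ := hT x u
  induction w with
  | nil => exact .inl .rfl
  | @cons x y z hxy _ ih =>
    by_cases he : s(x, y) = s(z, v)
    · rcases Sym2.eq_iff.1 he with ⟨rfl, -⟩ | ⟨rfl, -⟩
      · exact .inl .rfl
      · exact .inr .rfl
    · have hyx : (T.deleteEdges {s(z, v)}).Adj y x := by
        rw [deleteEdges_adj]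
        exact ⟨hxy.symm, fun h => he (Sym2.eq_swap.trans h)⟩
      exact ih.imp (·.trans hyx.reachable) (·.trans hyx.reachable)

/-- In a connected graph, a set with `u`-`v` as its only boundary edge is a side of `uv`. -/
lemma Connected.reachable_deleteEdges_iff {T : SimpleGraph τ} (hT : T.Connected) {S : Set τ}
    {u v x : τ} (hS : ∀ x y, T.Adj x y → x ∈ S → y ∉ S → s(x, y) = s(u, v))
    (huv : u ∈ S ↔ v ∉ S) :
    (T.deleteEdges {s(u, v)}).Reachable u x ↔ (u ∈ S ↔ x ∈ S) := by
  refine ⟨mem_iff_of_reachable_deleteEdges hS, fun h => ?_⟩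
  refine (hT.reachable_deleteEdges_or u v x).resolve_right fun hv => ?_
  have := mem_iff_of_reachable_deleteEdges hS hv
  tauto

/-- The degree of `v` in `T` once `n` further edges are attached to the root `r`. -/
noncomputable def pendingDegree (T : SimpleGraph τ) (r : τ) (n : ℕ) (v : τ) : ℕ :=
  (T.neighborSet v).ncard + if v = r then n else 0

/-- The disjoint union of two rooted graphs together with an edge joining the roots. -/
def joinRoots (T : SimpleGraph τ) (U : SimpleGraph σ) (r : τ) (s : σ) : SimpleGraph (τ ⊕ σ) :=
  (T ⊕g U) ⊔ edge (.inl r) (.inr s)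

section joinRoots

variable (T : SimpleGraph τ) (U : SimpleGraph σ) (r : τ) (s : σ)

@[simp] lemma joinRoots_adj_inl_inl {a b : τ} :
    (T.joinRoots U r s).Adj (.inl a) (.inl b) ↔ T.Adj a b := by
  simp [joinRoots, edge_adj]

@[simp] lemma joinRoots_adj_inr_inr {a b : σ} :
    (T.joinRoots U r s).Adj (.inr a) (.inr b) ↔ U.Adj a b := by
  simp [joinRoots, edge_adj]

@[simp] lemma joinRoots_adj_inl_inr {a : τ} {b : σ} :
    (T.joinRoots U r s).Adj (.inl a) (.inr b) ↔ a = r ∧ b = s := by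
  simp [joinRoots, edge_adj]

@[simp] lemma joinRoots_adj_inr_inl {a : τ} {b : σ} :
    (T.joinRoots U r s).Adj (.inr b) (.inl a) ↔ a = r ∧ b = s := by
  rw [adj_comm, joinRoots_adj_inl_inr]

lemma pendingDegree_joinRoots_inl [Finite τ] (n : ℕ) (a : τ) :
    (T.joinRoots U r s).pendingDegree (.inl r) n (.inl a) = T.pendingDegree r (n + 1) a := by
  unfold pendingDegree
  by_cases h : a = r
  · have : (T.joinRoots U r s).neighborSet (.inl a)
        = insert (.inr s) (Sum.inl '' T.neighborSet a) := by
      ext (x | x) <;> simp [h]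
    rw [this, Set.ncard_insert_of_notMem (by simp) (Set.toFinite _),
      Set.ncard_image_of_injective _ Sum.inl_injective]
    simp [h]
    omega
  · have : (T.joinRoots U r s).neighborSet (.inl a) = Sum.inl '' T.neighborSet a := by
      ext (x | x) <;> simp [h]
    rw [this, Set.ncard_image_of_injective _ Sum.inl_injective]
    simp [h]

lemma pendingDegree_joinRoots_inr [Finite σ] (n : ℕ) (b : σ) :
    (T.joinRoots U r s).pendingDegree (.inl r) n (.inr b) = U.pendingDegree s 1 b := by
  unfold pendingDegree
  by_cases h : b = s
  · have : (T.joinRoots U r s).neighborSet (.inr b)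
        = insert (.inl r) (Sum.inr '' U.neighborSet b) := by
      ext (x | x) <;> simp [h]
    rw [this, Set.ncard_insert_of_notMem (by simp) (Set.toFinite _),
      Set.ncard_image_of_injective _ Sum.inr_injective]
    simp [h]
  · have : (T.joinRoots U r s).neighborSet (.inr b) = Sum.inr '' U.neighborSet b := by
      ext (x | x) <;> simp [h]
    rw [this, Set.ncard_image_of_injective _ Sum.inr_injective]
    simp [h]

end joinRoots

end SimpleGraph

/-- `T`, with `n` further edges to be attached at its root `r`, is a subcubic tree whose leaves are
labelled bijectively by `A`, and every edge of `T` cuts off a set satisfying `p`. -/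
structure IsPartialDecomp {α τ : Type} (p : Set α → Prop) (n : ℕ) (A : Set α)
    (T : SimpleGraph τ) (r : τ) (ℓ : τ → α) : Prop where
  connected : T.Connected
  degree : ∀ v, T.pendingDegree r n v = 1 ∨ T.pendingDegree r n v = 3
  bijOn : Set.BijOn ℓ {v | T.pendingDegree r n v = 1} A
  cut : ∀ u v, T.Adj u v → ∃ S : Set τ, r ∉ S ∧ (u ∈ S ↔ v ∉ S) ∧
    (∀ x y, T.Adj x y → x ∈ S → y ∉ S → s(x, y) = s(u, v)) ∧
    p (ℓ '' {x | T.pendingDegree r n x = 1 ∧ x ∈ S})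

def HasPartialDecomp {α : Type} (p : Set α → Prop) (n : ℕ) (A : Set α) : Prop :=
  ∃ (τ : Type) (_ : Finite τ) (T : SimpleGraph τ) (r : τ) (ℓ : τ → α), IsPartialDecomp p n A T r ℓ

namespace HasPartialDecomp

variable {α : Type} {p : Set α → Prop}

lemma singleton (a : α) : HasPartialDecomp p 1 {a} := by
  refine ⟨Unit, inferInstance, ⊥, (), fun _ => a, ?_, ?_, ?_, ?_⟩
  · exact SimpleGraph.IsTree.of_subsingleton.connected
  · simp [SimpleGraph.pendingDegree, SimpleGraph.neighborSet]
  · simp [SimpleGraph.pendingDegree, SimpleGraph.neighborSet, Set.BijOn, Set.MapsTo, Set.SurjOn,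
      Set.InjOn]
  · simp

lemma empty (a : α) : HasPartialDecomp p 3 (∅ : Set α) := by
  refine ⟨Unit, inferInstance, ⊥, (), fun _ => a, ?_, ?_, ?_, ?_⟩
  · exact SimpleGraph.IsTree.of_subsingleton.connected
  · simp [SimpleGraph.pendingDegree, SimpleGraph.neighborSet]
  · simp [SimpleGraph.pendingDegree, SimpleGraph.neighborSet, Set.BijOn, Set.MapsTo, Set.SurjOn,
      Set.InjOn]
  · simp

lemma union {n : ℕ} {A B : Set α} (hA : HasPartialDecomp p (n + 1) A) (hB : HasPartialDecomp p 1 B)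
    (hAB : Disjoint A B) (hpB : p B) : HasPartialDecomp p n (A ∪ B) := by
  obtain ⟨τ, _, T, r, ℓ, hT⟩ := hA
  obtain ⟨σ, _, U, s, m, hU⟩ := hB
  have hl := fun a => T.pendingDegree_joinRoots_inl U r s n a
  have hr := fun b => T.pendingDegree_joinRoots_inr U r s n b
  refine ⟨τ ⊕ σ, inferInstance, T.joinRoots U r s, .inl r, Sum.elim ℓ m, ?_, ?_, ?_, ?_⟩
  · exact hT.connected.sum_sup_edge hU.connected
  · rintro (a | b)
    · rw [hl]; exact hT.degree a
    · rw [hr]; exact hU.degree b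
  · refine ⟨?_, ?_, ?_⟩
    · rintro (a | b) h
      · exact .inl (hT.bijOn.mapsTo ((hl a).symm.trans h))
      · exact .inr (hU.bijOn.mapsTo ((hr b).symm.trans h))
    · rintro (a | a) ha (b | b) hb h
      · exact congrArg _ (hT.bijOn.injOn ((hl a).symm.trans ha) ((hl b).symm.trans hb) h)
      · exact (hAB.ne_of_mem (hT.bijOn.mapsTo ((hl a).symm.trans ha))
          (hU.bijOn.mapsTo ((hr b).symm.trans hb)) h).elim
      · exact (hAB.ne_of_mem (hT.bijOn.mapsTo ((hl b).symm.trans hb))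
          (hU.bijOn.mapsTo ((hr a).symm.trans ha)) h.symm).elim
      · exact congrArg _ (hU.bijOn.injOn ((hr a).symm.trans ha) ((hr b).symm.trans hb) h)
    · rintro x (hx | hx)
      · obtain ⟨a, ha, rfl⟩ := hT.bijOn.surjOn hx
        exact ⟨.inl a, (hl a).trans ha, rfl⟩
      · obtain ⟨b, hb, rfl⟩ := hU.bijOn.surjOn hx
        exact ⟨.inr b, (hr b).trans hb, rfl⟩
  · have hmid : p (Sum.elim ℓ m '' {x | (T.joinRoots U r s).pendingDegree (.inl r) n x = 1 ∧
        x ∈ Set.range Sum.inr}) := by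
      convert hpB
      rw [← hU.bijOn.image_eq]
      ext x
      simp [hr]
    rintro (u | u) (v | v) huv
    · rw [SimpleGraph.joinRoots_adj_inl_inl] at huv
      obtain ⟨S, h1, h2, h3, h4⟩ := hT.cut u v huv
      refine ⟨Sum.inl '' S, by simpa, by simpa, ?_, ?_⟩
      · rintro (x | x) (y | y) hxy hx hy
        · simp only [SimpleGraph.joinRoots_adj_inl_inl, Sum.inl_injective.mem_set_image] at *
          exact congrArg (Sym2.map Sum.inl) (h3 x y hxy hx hy)
        · simp_all
        · simp_all
        · simp_all
      · convert h4
        ext x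
        simp [hl]
    · exact ⟨Set.range Sum.inr, by simp, by simp, by
        rintro (x | x) (y | y) hxy hx hy <;> simp_all, hmid⟩
    · exact ⟨Set.range Sum.inr, by simp, by simp, by
        rintro (x | x) (y | y) hxy hx hy <;> simp_all, hmid⟩
    · rw [SimpleGraph.joinRoots_adj_inr_inr] at huv
      obtain ⟨S, h1, h2, h3, h4⟩ := hU.cut u v huv
      refine ⟨Sum.inr '' S, by simp, by simpa, ?_, ?_⟩
      · rintro (x | x) (y | y) hxy hx hy
        · simp_all
        · simp_all
        · simp_all
        · simp only [SimpleGraph.joinRoots_adj_inr_inr, Sum.inr_injective.mem_set_image] at *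
          exact congrArg (Sym2.map Sum.inr) (h3 x y hxy hx hy)
      · convert h4
        ext x
        simp [hr]

lemma exists_branchDecomp [Fintype α] (hp : ∀ A, p A → p Aᶜ)
    (h : HasPartialDecomp p 0 (Set.univ : Set α)) :
    ∃ B : BranchDecomp α, ∀ u v, B.T.Adj u v → p (B.side u v) := by
  obtain ⟨τ, _, T, r, ℓ, hT⟩ := h
  have := Fintype.ofFinite τ
  have hdeg : ∀ v, T.pendingDegree r 0 v = T.degree v := fun v => by
    simp [SimpleGraph.pendingDegree, ← SimpleGraph.coe_neighborFinset, Set.ncard_coe_finset]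
  have htree : T.IsTree := by
    refine ⟨hT.connected, SimpleGraph.isAcyclic_iff_forall_adj_isBridge.2 fun u v huv => ?_⟩
    obtain ⟨S, -, h2, h3, -⟩ := hT.cut u v huv
    rw [SimpleGraph.isBridge_iff, hT.connected.reachable_deleteEdges_iff h3 h2]
    tauto
  have hbij := hT.bijOn
  have hdegree := hT.degree
  have hcut := hT.cut
  simp only [hdeg] at hbij hdegree hcut
  let δ : {v : τ // T.degree v = 1} ≃ α := Equiv.ofBijective (fun v => ℓ v)
    ⟨fun a b hab => Subtype.ext (hbij.injOn a.2 b.2 hab), fun x => by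
      obtain ⟨a, ha, hx⟩ := hbij.surjOn (Set.mem_univ x)
      exact ⟨⟨a, ha⟩, hx⟩⟩
  have hδ : ∀ S : Set τ, ℓ '' {x | T.degree x = 1 ∧ x ∈ S} = {x | (δ.symm x : τ) ∈ S} := by
    intro S
    ext x
    constructor
    · rintro ⟨y, ⟨hy, hyS⟩, rfl⟩
      have : δ.symm (ℓ y) = ⟨y, hy⟩ := by rw [Equiv.symm_apply_eq]; rfl
      simpa [this] using hyS
    · exact fun hx => ⟨_, ⟨(δ.symm x).2, hx⟩, δ.apply_symm_apply x⟩
  refine ⟨⟨τ, T, htree, hdegree, δ⟩, fun u v huv => ?_⟩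
  obtain ⟨S, -, h2, h3, h4⟩ := hcut u v huv
  rw [hδ] at h4
  by_cases hu : u ∈ S
  · convert h4 using 1
    ext x
    simp [BranchDecomp.side, hT.connected.reachable_deleteEdges_iff h3 h2, hu]
  · convert hp _ h4 using 1
    ext x
    simp [BranchDecomp.side, hT.connected.reachable_deleteEdges_iff h3 h2, hu]

end HasPartialDecomp

/-- Sets obtained from singletons by disjoint unions, all intermediate sets satisfying `p`. -/
inductive BinaryBuildable {α : Type} (p : Set α → Prop) : Set α → Prop
  | singleton (a : α) : p {a} → BinaryBuildable p {a}
  | union {A B : Set α} : BinaryBuildable p A → BinaryBuildable p B → Disjoint A B → p (A ∪ B) →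
      BinaryBuildable p (A ∪ B)

namespace BinaryBuildable

variable {α : Type} {p : Set α → Prop}

lemma prop {A : Set α} (h : BinaryBuildable p A) : p A := by
  cases h <;> assumption

lemma nonempty {A : Set α} (h : BinaryBuildable p A) : A.Nonempty := by
  induction h with
  | singleton a => exact Set.singleton_nonempty a
  | union _ _ _ _ ih _ => exact ih.inl

lemma hasPartialDecomp {A : Set α} (h : BinaryBuildable p A) : HasPartialDecomp p 1 A := by
  induction h with
  | singleton a => exact .singleton a
  | @union A B hA hB hAB _ ihA ihB =>
    have h := (HasPartialDecomp.empty hA.nonempty.some).union ihA (Set.empty_disjoint A) hA.prop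
    rw [Set.empty_union] at h
    exact h.union ihB hAB hB.prop

lemma exists_branchDecomp [Fintype α] (hα : 1 < Fintype.card α) (hp : ∀ A, p A → p Aᶜ)
    (h : BinaryBuildable p (Set.univ : Set α)) :
    ∃ B : BranchDecomp α, ∀ u v, B.T.Adj u v → p (B.side u v) := by
  apply HasPartialDecomp.exists_branchDecomp hp
  generalize hU : (Set.univ : Set α) = U at h
  cases h with
  | singleton a =>
    have := Set.subsingleton_univ_iff.1 (hU ▸ Set.subsingleton_singleton (a := a))
    exact absurd (Fintype.card_le_one_iff_subsingleton.2 this) (by omega)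
  | union hA hB hAB => exact hA.hasPartialDecomp.union hB.hasPartialDecomp hAB hB.prop

lemma of_forall_subset [Finite α] {A : Set α} (hA : A.Nonempty) (h : ∀ B ⊆ A, p B) :
    BinaryBuildable p A := by
  induction A, A.toFinite using Set.Finite.induction_on with
  | empty => exact absurd hA Set.not_nonempty_empty
  | @insert a s ha _ ih =>
    rcases s.eq_empty_or_nonempty with rfl | hs
    · rw [insert_empty_eq]
      exact .singleton a (h _ (by simp))
    · rw [Set.insert_eq]
      exact .union (.singleton a (h _ (by simp)))
        (ih hs fun B hB => h B (hB.trans (Set.subset_insert a s)))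
        (Set.disjoint_singleton_left.2 ha) (h _ (by rw [Set.insert_eq]))

end BinaryBuildable

namespace BranchDecomp

variable {β : Type} [Fintype β] (B : BranchDecomp β)

lemma not_reachable_deleteEdges {u v : B.τ} (h : B.T.Adj u v) :
    ¬ (B.T.deleteEdges {s(u, v)}).Reachable u v :=
  SimpleGraph.isBridge_iff.1
    (SimpleGraph.isAcyclic_iff_forall_adj_isBridge.1 B.isTree.isAcyclic h)

lemma disjoint_side {u v : B.τ} (h : B.T.Adj u v) : Disjoint (B.side u v) (B.side v u) := by
  rw [Set.disjoint_left]
  intro x hx hy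
  simp only [side, Set.mem_ofPred_eq, Sym2.eq_swap (a := v)] at hx hy
  exact B.not_reachable_deleteEdges h (hx.trans hy.symm)

lemma side_union_side (u v : B.τ) : B.side u v ∪ B.side v u = Set.univ := by
  ext x
  simpa [side, Sym2.eq_swap (a := v)] using
    B.isTree.connected.reachable_deleteEdges_or u v (B.δ.symm x : B.τ)

lemma reachable_deleteEdges_iff {u v x : B.τ} (huv : B.T.Adj u v) :
    (B.T.deleteEdges {s(u, v)}).Reachable u x ↔
      x = u ∨ ∃ w, B.T.Adj u w ∧ w ≠ v ∧ (B.T.deleteEdges {s(w, u)}).Reachable w x := by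
  have transfer : ∀ {a b w z : B.τ} (q : (B.T.deleteEdges {s(a, b)}).Walk w x),
      u ∉ q.support → (B.T.deleteEdges {s(u, z)}).Reachable w x := by
    intro a b w z q hq
    refine ⟨q.transfer _ fun e he => ?_⟩
    have he' := q.edges_subset_edgeSet he
    rw [SimpleGraph.edgeSet_deleteEdges] at he' ⊢
    refine ⟨he'.1, ?_⟩
    rintro rfl
    exact hq (q.fst_mem_support_of_mem_edges he)
  constructor
  · rintro h
    obtain ⟨q, hq⟩ := h.exists_isPath
    cases q with
    | nil => exact .inl rfl
    | @cons _ w _ huw q =>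
      rw [SimpleGraph.Walk.cons_isPath_iff] at hq
      rw [SimpleGraph.deleteEdges_adj] at huw
      refine .inr ⟨w, huw.1, ?_, ?_⟩
      · rintro rfl
        exact huw.2 rfl
      · rw [Sym2.eq_swap]
        exact transfer q hq.2
  · rintro (rfl | ⟨w, huw, hwv, ⟨q⟩⟩)
    · rfl
    · have hadj : (B.T.deleteEdges {s(u, v)}).Adj u w := by
        rw [SimpleGraph.deleteEdges_adj]
        exact ⟨huw, fun h => hwv (Sym2.congr_right.1 h)⟩
      refine hadj.reachable.trans (transfer q fun hu => ?_)
      exact B.not_reachable_deleteEdges huw.symm ⟨q.takeUntil u hu⟩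

/-- To prove a property of the whole ground set, build it up along the branch decomposition. -/
theorem induction_univ {q : Set β → Prop} (single : ∀ b, q {b})
    (union : ∀ X Y, q X → q Y → Disjoint X Y →
      (X ∪ Y = Set.univ ∨ ∃ u v, B.T.Adj u v ∧ B.side u v = X ∪ Y) → q (X ∪ Y)) :
    q Set.univ := by
  have key : ∀ (n : ℕ) (u v : B.τ), B.T.Adj u v →
      {x | (B.T.deleteEdges {s(u, v)}).Reachable u x}.ncard = n → q (B.side u v) := by
    intro n
    induction n using Nat.strong_induction_on with
    | _ n ih =>
    rintro u v huv rfl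
    have hchild : ∀ w, B.T.Adj u w → w ≠ v → q (B.side w u) := by
      intro w hw hwv
      refine ih _ (Set.ncard_lt_ncard ?_ (Set.toFinite _)) w u hw.symm rfl
      refine (Set.ssubset_iff_of_subset fun x hx => ?_).2 ⟨u, .rfl, ?_⟩
      · exact (B.reachable_deleteEdges_iff huv).2 (.inr ⟨w, hw, hwv, hx⟩)
      · exact B.not_reachable_deleteEdges hw.symm
    rcases B.deg u with hu | hu
    · convert single (B.δ ⟨u, hu⟩)
      obtain ⟨a, ha⟩ := Finset.card_eq_one.1 hu
      have hnbr : ∀ w, B.T.Adj u w ↔ w = a := by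
        intro w; rw [← SimpleGraph.mem_neighborFinset, ha, Finset.mem_singleton]
      ext x
      simp only [side, Set.mem_ofPred_eq, B.reachable_deleteEdges_iff huv, Set.mem_singleton_iff]
      constructor
      · rintro (hx | ⟨w, hw, hwv, -⟩)
        · rw [← Equiv.symm_apply_eq]
          exact Subtype.ext hx
        · exact absurd (((hnbr w).1 hw).trans ((hnbr v).1 huv).symm) hwv
      · rintro rfl
        simp
    · have hv : v ∈ B.T.neighborFinset u := by simpa
      obtain ⟨a, b, hab, hs⟩ := Finset.card_eq_two.1
        (show ((B.T.neighborFinset u).erase v).card = 2 by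
          rw [Finset.card_erase_of_mem hv, SimpleGraph.card_neighborFinset_eq_degree, hu])
      have hnbr : ∀ w, (w ≠ v ∧ B.T.Adj u w) ↔ w = a ∨ w = b := by
        intro w
        rw [← SimpleGraph.mem_neighborFinset, ← Finset.mem_erase, hs]
        simp
      obtain ⟨hav, hua⟩ := (hnbr a).2 (.inl rfl)
      obtain ⟨hbv, hub⟩ := (hnbr b).2 (.inr rfl)
      have hside : B.side u v = B.side a u ∪ B.side b u := by
        ext x
        simp only [side, Set.mem_ofPred_eq, B.reachable_deleteEdges_iff huv, Set.mem_union]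
        constructor
        · rintro (hx | ⟨w, hw, hwv, h⟩)
          · have := (B.δ.symm x).2
            rw [hx, hu] at this
            omega
          · rcases (hnbr w).1 ⟨hwv, hw⟩ with rfl | rfl
            exacts [.inl h, .inr h]
        · rintro (h | h)
          exacts [.inr ⟨a, hua, hav, h⟩, .inr ⟨b, hub, hbv, h⟩]
      rw [hside]
      refine union _ _ (hchild a hua hav) (hchild b hub hbv) ?_ (.inr ⟨u, v, huv, hside⟩)
      refine (B.disjoint_side hua).symm.mono_right fun x hx => ?_
      exact (B.reachable_deleteEdges_iff hua).2 (.inr ⟨b, hub, hab.symm, hx⟩)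
  obtain ⟨u⟩ := B.isTree.connected.nonempty
  have hu : 0 < B.T.degree u := by rcases B.deg u with h | h <;> omega
  obtain ⟨v, huv⟩ := (B.T.degree_pos_iff_exists_adj u).1 hu
  rw [← B.side_union_side u v]
  exact union _ _ (key _ u v huv rfl) (key _ v u huv.symm rfl) (B.disjoint_side huv)
    (.inl (B.side_union_side u v))

lemma le_width (f : Set β → ℕ) {u v : B.τ} (h : B.T.Adj u v) : f (B.side u v) ≤ B.width f := by
  refine le_csSup (Set.Finite.bddAbove ?_) ⟨u, v, h, rfl⟩
  refine (Set.finite_range fun e : B.τ × B.τ => f (B.side e.1 e.2)).subset ?_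
  rintro _ ⟨u, v, -, rfl⟩
  exact ⟨(u, v), rfl⟩

lemma width_le {f : Set β → ℕ} {k : ℕ} (h : ∀ u v, B.T.Adj u v → f (B.side u v) ≤ k) :
    B.width f ≤ k := by
  refine csSup_le' ?_
  rintro _ ⟨u, v, huv, rfl⟩
  exact h u v huv

end BranchDecomp

lemma exists_branchDecomp_of_one_lt_card {α : Type} [Fintype α] (h : 1 < Fintype.card α) :
    Nonempty (BranchDecomp α) := by
  have : Nonempty α := Fintype.card_pos_iff.1 (by omega)
  obtain ⟨B, -⟩ := (BinaryBuildable.of_forall_subset (p := fun _ : Set α => True)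
    Set.univ_nonempty fun _ _ => trivial).exists_branchDecomp h fun _ _ => trivial
  exact ⟨B⟩

lemma exists_width_le_of_fWidth_le {α : Type} [Fintype α] (hα : 1 < Fintype.card α)
    {f : Set α → ℕ} {k : ℕ} (h : fWidth α f ≤ k) : ∃ B : BranchDecomp α, B.width f ≤ k := by
  rw [fWidth, if_neg (by omega)] at h
  obtain ⟨B₀⟩ := exists_branchDecomp_of_one_lt_card hα
  obtain ⟨B, hB⟩ := Nat.sInf_mem (s := {n | ∃ B : BranchDecomp α, B.width f = n}) ⟨_, B₀, rfl⟩
  exact ⟨B, hB.trans_le h⟩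

/-- `D` meets every edge of `G` between `A` and its complement. -/
def CoversCut {V : Type} (G : SimpleGraph V) (A D : Set V) : Prop :=
  ∀ u ∈ A, ∀ v ∉ A, G.Adj u v → u ∈ D ∨ v ∈ D

lemma CoversCut.compl {V : Type} {G : SimpleGraph V} {A D : Set V} (h : CoversCut G A D) :
    CoversCut G Aᶜ D :=
  fun u hu v hv huv => (h v (not_not.1 hv) u hu huv.symm).symm

lemma CoversCut.cutRank_le (F : Type) [Field F] {V : Type} [Fintype V] {G : SimpleGraph V}
    {A D : Set V} (h : CoversCut G A D) : cutRank F G A ≤ D.ncard := by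
  let P : Matrix A D F := .of fun u d =>
    if d.1 ∈ A then (if u.1 = d.1 then 1 else 0)
    else if u.1 ∈ D then 0 else if G.Adj u.1 d.1 then 1 else 0
  let Q : Matrix D ↥Aᶜ F := .of fun d v =>
    if d.1 ∈ A then (if G.Adj d.1 v.1 then 1 else 0) else if v.1 = d.1 then 1 else 0
  have hPQ : Matrix.of (fun (u : A) (v : ↥Aᶜ) => if G.Adj u.1 v.1 then (1 : F) else 0) = P * Q := by
    ext ⟨u, hu⟩ ⟨v, hv⟩
    rw [Matrix.mul_apply]
    simp only [P, Q, Matrix.of_apply]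
    by_cases huD : u ∈ D
    · rw [Finset.sum_eq_single ⟨u, huD⟩]
      · simp [hu]
      · rintro ⟨d, hd⟩ - hne
        have : u ≠ d := fun h => hne (Subtype.ext h.symm)
        by_cases hdA : d ∈ A <;> simp [hdA, this, huD]
      · simp
    · by_cases hvD : v ∈ D
      · rw [Finset.sum_eq_single ⟨v, hvD⟩]
        · rw [Set.mem_compl_iff] at hv
          simp [hv, huD]
        · rintro ⟨d, hd⟩ - hne
          have h1 : v ≠ d := fun h => hne (Subtype.ext h.symm)
          have h2 : u ≠ d := fun h => huD (h ▸ hd)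
          by_cases hdA : d ∈ A <;> simp [hdA, h1, h2]
        · simp
      · rw [Finset.sum_eq_zero]
        · rw [if_neg]
          intro huv
          exact (h u hu v hv huv).elim huD hvD
        · rintro ⟨d, hd⟩ -
          have h1 : v ≠ d := fun h => hvD (h ▸ hd)
          have h2 : u ≠ d := fun h => huD (h ▸ hd)
          by_cases hdA : d ∈ A <;> simp [hdA, h1, h2]
  rw [cutRank, hPQ, ← Nat.card_coe_set_eq, Nat.card_eq_fintype_card]
  exact (Matrix.rank_mul_le_left P Q).trans P.rank_le_card_width

lemma ncard_setOf_mem_le_two {V : Type} (e : Sym2 V) : {v | v ∈ e}.ncard ≤ 2 := by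
  induction e with
  | _ a b =>
    have : {v | v ∈ s(a, b)} = {a, b} := by
      ext v
      simp
    rw [this]
    exact (Set.ncard_insert_le a {b}).trans (by simp)

/-- The cut between the vertices whose representative edge lies in `X` and the other vertices
is covered by the vertices counted by `eta G X`. -/
lemma coversCut_preimage {V : Type} {G : SimpleGraph V} (ε : V → G.edgeSet)
    (hε : ∀ u v, G.Adj u v → u ∈ (ε u).1) (X : Set G.edgeSet) :
    CoversCut G (ε ⁻¹' X)
      (incVerts (Subtype.val '' X) ∩ incVerts (G.edgeSet \ Subtype.val '' X)) := by
  intro u hu v hv huv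
  have hv' : (ε v).1 ∉ Subtype.val '' X := by
    rwa [Subtype.val_injective.mem_set_image]
  have hu' : (ε u).1 ∈ Subtype.val '' X := ⟨_, hu, rfl⟩
  by_cases he : s(u, v) ∈ Subtype.val '' X
  · exact .inr ⟨⟨_, he, by simp⟩, ⟨_, ⟨(ε v).2, hv'⟩, hε v u huv.symm⟩⟩
  · exact .inl ⟨⟨_, hu', hε u v huv⟩, ⟨_, ⟨huv, he⟩, by simp⟩⟩

/-- Every graph with an edge has a map sending each non-isolated vertex to an incident edge. -/
lemma exists_incident_edge {V : Type} {G : SimpleGraph V} (e₀ : G.edgeSet) :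
    ∃ ε : V → G.edgeSet, ∀ u v, G.Adj u v → u ∈ (ε u).1 := by
  have : ∀ u, ∃ e : G.edgeSet, ∀ v, G.Adj u v → u ∈ e.1 := by
    intro u
    by_cases h : ∃ v, G.Adj u v
    · obtain ⟨v, hv⟩ := h
      exact ⟨⟨s(u, v), hv⟩, fun _ _ => by simp⟩
    · exact ⟨e₀, fun v hv => absurd ⟨v, hv⟩ h⟩
  exact ⟨fun u => (this u).choose, fun u => (this u).choose_spec⟩

/-- A branch decomposition of the edges of `G` yields a hierarchical decomposition of its vertices
whose cuts have small covers. -/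
lemma binaryBuildable_univ {V : Type} [Fintype V] [Nonempty V] {G : SimpleGraph V} {k : ℕ}
    (hk : 2 ≤ k) (h : graphBranchWidth G ≤ k) :
    BinaryBuildable (fun A => ∃ D : Set V, CoversCut G A D ∧ D.ncard ≤ k) Set.univ := by
  have small : ∀ (e : Sym2 V) (A : Set V), A.Nonempty →
      (∀ u ∈ A, ∀ v, G.Adj u v → u ∈ e) →
      BinaryBuildable (fun A => ∃ D : Set V, CoversCut G A D ∧ D.ncard ≤ k) A := by
    intro e A hA he
    refine .of_forall_subset hA fun B hB => ⟨{v | v ∈ e}, ?_, (ncard_setOf_mem_le_two e).trans hk⟩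
    exact fun u hu v _ huv => .inl (he u (hB hu) v huv)
  by_cases hE : 1 < Fintype.card G.edgeSet
  · obtain ⟨B, hB⟩ := exists_width_le_of_fWidth_le hE h
    obtain ⟨e₀⟩ : Nonempty G.edgeSet := Fintype.card_pos_iff.1 (by omega)
    obtain ⟨ε, hε⟩ := exists_incident_edge e₀
    have key : (ε ⁻¹' Set.univ).Nonempty → BinaryBuildable
        (fun A => ∃ D : Set V, CoversCut G A D ∧ D.ncard ≤ k) (ε ⁻¹' Set.univ) := by
      refine B.induction_univ (q := fun X => (ε ⁻¹' X).Nonempty → BinaryBuildable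
        (fun A => ∃ D : Set V, CoversCut G A D ∧ D.ncard ≤ k) (ε ⁻¹' X)) ?_ ?_
      · intro e he
        refine small e _ he fun u hu v huv => ?_
        have := hε u v huv
        rwa [show ε u = e from hu] at this
      · intro X Y hX hY hXY hside hne
        rcases (ε ⁻¹' X).eq_empty_or_nonempty with hX' | hX'
        · rw [Set.preimage_union, hX', Set.empty_union] at hne ⊢
          exact hY hne
        rcases (ε ⁻¹' Y).eq_empty_or_nonempty with hY' | hY'
        · rw [Set.preimage_union, hY', Set.union_empty]
          exact hX hX'
        rw [Set.preimage_union]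
        refine .union (hX hX') (hY hY') (hXY.preimage ε) ?_
        rw [← Set.preimage_union]
        rcases hside with hXY' | ⟨u, v, huv, hXY'⟩
        · rw [hXY']
          exact ⟨∅, fun _ _ v hv => absurd (Set.mem_univ v) hv, by simp⟩
        · rw [← hXY']
          exact ⟨_, coversCut_preimage ε hε _, (B.le_width (etaE G) huv).trans hB⟩
    exact key Set.univ_nonempty
  · have hsub := Fintype.card_le_one_iff_subsingleton.1 (not_lt.1 hE)
    obtain ⟨v₀⟩ := ‹Nonempty V›
    by_cases hG : Nonempty G.edgeSet
    · obtain ⟨e⟩ := hG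
      refine small e _ Set.univ_nonempty fun u _ v huv => ?_
      rw [← Subsingleton.elim (⟨s(u, v), huv⟩ : G.edgeSet) e]
      simp
    · exact small s(v₀, v₀) _ Set.univ_nonempty fun u _ v huv => (hG ⟨⟨s(u, v), huv⟩⟩).elim

theorem stmt5 {V : Type} [Fintype V] (G : SimpleGraph V) (k : ℕ) (hk : 2 ≤ k)
    (h : k + 1 ≤ qRankWidth G) : k + 1 ≤ graphBranchWidth G := by
  by_contra! hlt
  have hbw : graphBranchWidth G ≤ k := by omega
  by_cases hV : Fintype.card V ≤ 1
  · have hrank : qRankWidth G ≤ (∅ : Set V).ncard := by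
      rw [qRankWidth, fWidth, if_pos hV]
      exact CoversCut.cutRank_le ℚ fun u hu => absurd hu (Set.notMem_empty u)
    rw [Set.ncard_empty] at hrank
    omega
  · have : Nonempty V := Fintype.card_pos_iff.1 (by omega)
    obtain ⟨B, hB⟩ := (binaryBuildable_univ hk hbw).exists_branchDecomp (by omega)
      fun A ⟨D, hD, hDk⟩ => ⟨D, hD.compl, hDk⟩
    have hle : qRankWidth G ≤ B.width (cutRank ℚ G) := by
      rw [qRankWidth, fWidth, if_neg hV]
      exact Nat.sInf_le ⟨B, rfl⟩
    have hwidth : B.width (cutRank ℚ G) ≤ k := B.width_le fun u v huv => by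
      obtain ⟨D, hD, hDk⟩ := hB u v huv
      exact (hD.cutRank_le ℚ).trans hDk
    omega
end

section
/- Let G be a finite simple graph, let d be a positive integer, let A ⊆ V(G), and let k = cutrk^ℚ_G(A). Then for every subset S ⊆ A there exists a subset R ⊆ S such that |R| ≤ d·k and R ≡_A^d S. -/
open scoped Classical

/-- `X ≡_A^d Y` : `X` and `Y` are `d`-neighbour equivalent over the cut `(A, Aᶜ)`. -/
def nEquiv {V : Type} [Fintype V] (G : SimpleGraph V) (A : Set V) (d : ℕ)
    (X Y : Set V) : Prop :=
  ∀ v ∈ Aᶜ, min d (G.neighborSet v ∩ X).ncard = min d (G.neighborSet v ∩ Y).ncard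

/-- A subset of `A` each of whose vertices has a private neighbour outside `A` has at most
`cutRank F G A` elements. -/
theorem ncard_le_cutRank_of_private_neighbor (F : Type) [Field F] {V : Type} [Fintype V]
    (G : SimpleGraph V) {A T : Set V} (hT : T ⊆ A)
    (h : ∀ t ∈ T, ∃ v ∈ Aᶜ, G.neighborSet v ∩ T = {t}) :
    T.ncard ≤ cutRank F G A := by
  choose! f hfA hf using h
  have hle := Matrix.rank_submatrix_le
    (Matrix.of (fun (u : A) (v : ↥Aᶜ) => if G.Adj u.1 v.1 then (1 : F) else 0))
    (fun t : T => ⟨t.1, hT t.2⟩) (fun t : T => ⟨f t.1, hfA t.1 t.2⟩)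
  have hone : (Matrix.of (fun (u : A) (v : ↥Aᶜ) => if G.Adj u.1 v.1 then (1 : F) else 0)).submatrix
      (fun t : T => ⟨t.1, hT t.2⟩) (fun t : T => ⟨f t.1, hfA t.1 t.2⟩) = 1 := by
    ext s t
    have hs := Set.ext_iff.mp (hf t.1 t.2) s.1
    simp only [Set.mem_inter_iff, SimpleGraph.mem_neighborSet, s.2, and_true,
      Set.mem_singleton_iff] at hs
    simp [Matrix.one_apply, G.adj_comm s.1, hs, Subtype.ext_iff]
  rw [hone, Matrix.rank_one, ← Nat.card_eq_fintype_card, Nat.card_coe_set_eq] at hle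
  exact hle

/-- Every `S ⊆ A` has a subset of at most `cutRank F G A` vertices that meets the neighbourhood of
every vertex outside `A` whose neighbourhood meets `S`. -/
theorem exists_subset_ncard_le_cutRank (F : Type) [Field F] {V : Type} [Fintype V]
    (G : SimpleGraph V) {A S : Set V} (hS : S ⊆ A) :
    ∃ T ⊆ S, T.ncard ≤ cutRank F G A ∧
      ∀ v ∈ Aᶜ, (G.neighborSet v ∩ S).Nonempty → (G.neighborSet v ∩ T).Nonempty := by
  obtain ⟨T, hTS, ⟨hT, hmin⟩⟩ := exists_minimal_le_of_wellFoundedLT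
    (fun T : Set V => ∀ v ∈ Aᶜ, (G.neighborSet v ∩ S).Nonempty → (G.neighborSet v ∩ T).Nonempty)
    S (fun _ _ h => h)
  refine ⟨T, hTS, ncard_le_cutRank_of_private_neighbor F G (hTS.trans hS) fun t ht => ?_, hT⟩
  by_contra! hne
  refine (hmin (y := T \ {t}) (fun v hv hvS => ?_) Set.sdiff_subset ht).2 rfl
  obtain ⟨x, hx⟩ := hT v hv hvS
  by_contra hempty
  have hsub : ∀ y ∈ G.neighborSet v ∩ T, y = t := fun y hy => by
    by_contra hyt
    exact hempty ⟨y, hy.1, hy.2, hyt⟩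
  exact hne v hv (Set.eq_singleton_iff_unique_mem.mpr ⟨hsub x hx ▸ hx, hsub⟩)

theorem exists_subset_ncard_le_mul_cutRank (F : Type) [Field F] {V : Type} [Fintype V]
    (G : SimpleGraph V) {A S : Set V} (hS : S ⊆ A) (d : ℕ) :
    ∃ R ⊆ S, R.ncard ≤ d * cutRank F G A ∧
      ∀ v ∈ Aᶜ, min d (G.neighborSet v ∩ S).ncard ≤ (G.neighborSet v ∩ R).ncard := by
  induction d with
  | zero => exact ⟨∅, Set.empty_subset S, by simp⟩
  | succ d ih =>
    obtain ⟨R, hRS, hR, hRd⟩ := ih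
    obtain ⟨T, hTS, hT, hTd⟩ :=
      exists_subset_ncard_le_cutRank F G (Set.sdiff_subset.trans hS : S \ R ⊆ A)
    refine ⟨R ∪ T, Set.union_subset hRS (hTS.trans Set.sdiff_subset), ?_, fun v hv => ?_⟩
    · have := Set.ncard_union_le R T
      rw [Nat.succ_mul]
      omega
    · have hdisj : Disjoint (G.neighborSet v ∩ R) (G.neighborSet v ∩ T) :=
        (Set.disjoint_left.mpr fun x hxR hxT => (hTS hxT).2 hxR).mono
          Set.inter_subset_right Set.inter_subset_right
      rw [Set.inter_union_distrib_left, Set.ncard_union_eq hdisj]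
      have hRv := hRd v hv
      by_cases hne : (G.neighborSet v ∩ (S \ R)).Nonempty
      · have := (Set.ncard_pos).mpr (hTd v hv hne)
        omega
      · have hsub : G.neighborSet v ∩ S ⊆ G.neighborSet v ∩ R := fun x hx => by
          by_contra hxR
          exact hne ⟨x, hx.1, hx.2, fun h => hxR ⟨hx.1, h⟩⟩
        have := Set.ncard_le_ncard hsub
        omega

theorem stmt7 {V : Type} [Fintype V] (G : SimpleGraph V) (d : ℕ) (hd : 0 < d)
    (A : Set V) (k : ℕ) (hk : k = cutRank ℚ G A) (S : Set V) (hS : S ⊆ A) :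
    ∃ R ⊆ S, R.ncard ≤ d * k ∧ nEquiv G A d R S := by
  obtain ⟨R, hRS, hR, hRd⟩ := exists_subset_ncard_le_mul_cutRank ℚ G hS d
  refine ⟨R, hRS, hk ▸ hR, fun v hv => ?_⟩
  have h₁ := hRd v hv
  have h₂ := Set.ncard_le_ncard (Set.inter_subset_inter_right (G.neighborSet v) hRS)
  omega
end

section
/- Let G be a finite simple graph and A ⊆ V(G). Then for every subset S ⊆ A there exists a subset R ⊆ S such that |R| ≤ cutrk^ℚ_G(A) and R ≡_A^1 S, i.e., a vertex of V(G)∖A has a neighbour in R if and only if it has a neighbour in S. -/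
open scoped Classical

/-- If every vertex of `R ⊆ A` has a private neighbour outside `A`, then the rows of the cut matrix
indexed by `R` are linearly independent, so `R` has at most `cutRank F G A` elements. -/
theorem ncard_le_cutRank_of_private_neighbors (F : Type) [Field F] {V : Type} [Fintype V]
    (G : SimpleGraph V) {A R : Set V} (hR : R ⊆ A)
    (h : ∀ u ∈ R, ∃ v ∈ Aᶜ, ∀ w ∈ R, G.Adj w v ↔ w = u) :
    R.ncard ≤ cutRank F G A := by
  choose f hfA hf using h
  set M : Matrix A ↥Aᶜ F := Matrix.of fun u v => if G.Adj u.1 v.1 then (1 : F) else 0 with hM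
  have hli : LinearIndependent F fun r : R => M ⟨r.1, hR r.2⟩ := by
    rw [Fintype.linearIndependent_iff]
    intro g hg i
    have hi := congrFun hg ⟨f i.1 i.2, hfA i.1 i.2⟩
    rw [Finset.sum_apply, Finset.sum_eq_single i] at hi
    · simpa [hM, hf i.1 i.2 i.1 i.2] using hi
    · intro b _ hb
      have hne : b.1 ≠ i.1 := fun h => hb (Subtype.ext h)
      simp [hM, hf i.1 i.2 b.1 b.2, hne]
    · simp
  rw [← Nat.card_coe_set_eq, Nat.card_eq_fintype_card, cutRank, ← hM,
    Matrix.rank_eq_finrank_span_row, ← finrank_span_eq_card hli]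
  refine Submodule.finrank_mono (Submodule.span_mono ?_)
  rintro _ ⟨r, rfl⟩
  exact ⟨⟨r.1, hR r.2⟩, rfl⟩

theorem nEquiv_one_of_subset {V : Type} [Fintype V] (G : SimpleGraph V) {A R S : Set V}
    (hRS : R ⊆ S) (h : ∀ v ∈ Aᶜ, (∃ u ∈ S, G.Adj u v) → ∃ u ∈ R, G.Adj u v) :
    nEquiv G A 1 R S := by
  intro v hv
  have hle : (G.neighborSet v ∩ R).ncard ≤ (G.neighborSet v ∩ S).ncard :=
    Set.ncard_le_ncard (Set.inter_subset_inter_right _ hRS)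
  have hpos : 0 < (G.neighborSet v ∩ S).ncard → 0 < (G.neighborSet v ∩ R).ncard := by
    rw [Set.ncard_pos, Set.ncard_pos]
    rintro ⟨u, hvu, hu⟩
    obtain ⟨w, hw, hwv⟩ := h v hv ⟨u, hu, SimpleGraph.Adj.symm hvu⟩
    exact ⟨w, hwv.symm, hw⟩
  omega

theorem stmt8 {V : Type} [Fintype V] (G : SimpleGraph V) (A : Set V)
    (S : Set V) (hS : S ⊆ A) :
    ∃ R ⊆ S, R.ncard ≤ cutRank ℚ G A ∧ nEquiv G A 1 R S := by
  let P : Set V → Prop := fun R =>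
    R ⊆ S ∧ ∀ v ∈ Aᶜ, (∃ u ∈ S, G.Adj u v) → ∃ u ∈ R, G.Adj u v
  obtain ⟨R, hR⟩ := (Set.toFinite {R | P R}).exists_minimal ⟨S, subset_rfl, fun _ _ h => h⟩
  obtain ⟨hRS, hdom⟩ := hR.prop
  refine ⟨R, hRS, ncard_le_cutRank_of_private_neighbors ℚ G (hRS.trans hS) fun u hu => ?_,
    nEquiv_one_of_subset G hRS hdom⟩
  have hnot : ¬ ∀ v ∈ Aᶜ, (∃ u ∈ S, G.Adj u v) → ∃ w ∈ R \ {u}, G.Adj w v := fun h =>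
    (hR.le_of_le ⟨Set.sdiff_subset.trans hRS, h⟩ Set.sdiff_subset hu).2 rfl
  push Not at hnot
  obtain ⟨v, hv, hSv, hpriv⟩ := hnot
  have huniq : ∀ w ∈ R, G.Adj w v → w = u := fun w hw hwv =>
    by_contra fun hne => hpriv w ⟨hw, hne⟩ hwv
  obtain ⟨w, hw, hwv⟩ := hdom v hv hSv
  exact ⟨v, hv, fun x hx => ⟨huniq x hx, fun hxu => by rwa [hxu, ← huniq w hw hwv]⟩⟩
end

section
/- Let G be a finite simple graph, A ⊆ V(G), and S' ⊆ A. Suppose S' is minimal under inclusion with respect to its 1-neighbour equivalence class, i.e., no proper subset R ⊊ S' satisfies R ≡_A^1 S'. Then |S'| ≤ cutrk^ℚ_G(A). -/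
open scoped Classical

/-- If `S` is inclusion-minimal in its `1`-neighbour equivalence class, then every `s ∈ S` has a
private neighbour outside `A`. -/
theorem exists_private_neighbor {V : Type} [Fintype V] (G : SimpleGraph V) (A S : Set V)
    (hmin : ∀ R : Set V, R ⊂ S → ¬ nEquiv G A 1 R S) {s : V} (hs : s ∈ S) :
    ∃ v ∈ Aᶜ, ∀ t ∈ S, G.Adj t v ↔ t = s := by
  have h := hmin (S \ {s}) (Set.sdiff_singleton_ssubset.2 hs)
  unfold nEquiv at h
  push Not at h
  obtain ⟨v, hv, hne⟩ := h
  have hunique : ∀ t ∈ S, G.Adj t v → t = s := by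
    intro t ht hadj
    by_contra hts
    have h1 : 0 < (G.neighborSet v ∩ (S \ {s})).ncard :=
      (Set.ncard_pos (Set.toFinite _)).2 ⟨t, hadj.symm, ht, hts⟩
    have h2 : 0 < (G.neighborSet v ∩ S).ncard :=
      (Set.ncard_pos (Set.toFinite _)).2 ⟨t, hadj.symm, ht⟩
    omega
  refine ⟨v, hv, fun t ht => ⟨hunique t ht, ?_⟩⟩
  rintro rfl
  by_contra hadj
  refine hne (congrArg (fun X : Set V => min 1 X.ncard) ?_)
  ext u
  simp only [Set.mem_inter_iff, Set.mem_sdiff, Set.mem_singleton_iff, SimpleGraph.mem_neighborSet]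
  refine ⟨fun hu => ⟨hu.1, hu.2.1⟩, fun hu => ⟨hu.1, hu.2, ?_⟩⟩
  rintro rfl
  exact hadj hu.1.symm

theorem stmt9 {V : Type} [Fintype V] (G : SimpleGraph V) (A : Set V)
    (S' : Set V) (hS' : S' ⊆ A)
    (hmin : ∀ R : Set V, R ⊂ S' → ¬ nEquiv G A 1 R S') :
    S'.ncard ≤ cutRank ℚ G A := by
  choose f hfA hf using fun s : S' => exists_private_neighbor G A S' hmin s.2
  let M : Matrix A ↥Aᶜ ℚ := Matrix.of fun u v => if G.Adj u.1 v.1 then (1 : ℚ) else 0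
  have hone : M.submatrix (fun s : S' => ⟨s.1, hS' s.2⟩) (fun s : S' => ⟨f s, hfA s⟩) = 1 := by
    ext t s
    simp [M, Matrix.one_apply, hf s t t.2, Subtype.ext_iff]
  calc S'.ncard = (1 : Matrix S' S' ℚ).rank := by
        rw [Matrix.rank_one, ← Nat.card_coe_set_eq, Nat.card_eq_fintype_card]
    _ ≤ M.rank := hone ▸ Matrix.rank_submatrix_le M _ _
    _ = cutRank ℚ G A := rfl
end

section
/- Let G be a finite simple graph, A ⊆ V(G), and let d ≥ 2 be an integer. Let S ⊆ A, let S₁ ⊆ S satisfy S₁ ≡_A^1 S, and let S₂ ⊆ S∖S₁ satisfy S₂ ≡_A^{d−1} (S∖S₁). Then S₁ ∪ S₂ ≡_A^d S. -/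
open scoped Classical

theorem stmt10 {V : Type} [Fintype V] (G : SimpleGraph V) (A : Set V)
    (d : ℕ) (hd : 2 ≤ d) (S S₁ S₂ : Set V) (hS : S ⊆ A)
    (hS₁ : S₁ ⊆ S) (h₁ : nEquiv G A 1 S₁ S)
    (hS₂ : S₂ ⊆ S \ S₁) (h₂ : nEquiv G A (d - 1) S₂ (S \ S₁)) :
    nEquiv G A d (S₁ ∪ S₂) S := by
  intro v hv
  have hdis : ∀ {X Y : Set V}, Disjoint X Y →
      (G.neighborSet v ∩ (X ∪ Y)).ncard =
        (G.neighborSet v ∩ X).ncard + (G.neighborSet v ∩ Y).ncard := by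
    intro X Y h
    rw [Set.inter_union_distrib_left]
    exact Set.ncard_union_eq (h.mono Set.inter_subset_right Set.inter_subset_right)
  have hU := hdis (Set.disjoint_sdiff_right.mono_right hS₂ : Disjoint S₁ S₂)
  have hT := hdis (Set.disjoint_sdiff_right : Disjoint S₁ (S \ S₁))
  rw [Set.union_sdiff_cancel hS₁] at hT
  have e₁ := h₁ v hv
  have e₂ := h₂ v hv
  omega
end

section
/- Let G be a finite simple graph, let d be a positive integer, let A ⊆ V(G), and let k = cutrk^ℚ_G(A). Then the number nec_d(A) of equivalence classes of the d-neighbour equivalence relation ≡_A^d on the subsets of A is at most (d·k + 1)^k. -/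
open scoped Classical

/-- `nec G d A` : the number of equivalence classes of `≡_A^d` on the subsets of `A`. -/
noncomputable def nec {V : Type} [Fintype V] (G : SimpleGraph V) (d : ℕ) (A : Set V) : ℕ :=
  Set.ncard { C : Set (Set V) | ∃ X, X ⊆ A ∧ C = { Y | Y ⊆ A ∧ nEquiv G A d X Y } }

/-- The number of elements of `X` related to `v`. -/
noncomputable def relCount {m n : Type} (R : m → n → Prop) (X : Finset m) (v : n) : ℕ :=
  (X.filter (fun u => R u v)).card

/-- The 0/1 matrix of a relation over `ℚ`. -/
noncomputable def relMatrix {m n : Type} (R : m → n → Prop) : Matrix m n ℚ :=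
  Matrix.of (fun u v => if R u v then (1 : ℚ) else 0)

theorem exists_column_basis {m n ι : Type} [Fintype m] [Fintype n] (M : Matrix m n ℚ)
    (f : ι → n) :
    ∃ (κ : Type) (_ : Fintype κ) (a : κ → ι),
      Fintype.card κ ≤ M.rank ∧
      ∀ i, M.col (f i) ∈ Submodule.span ℚ (Set.range fun j => M.col (f (a j))) := by
  obtain ⟨κ, a, -, hspan, hli⟩ := exists_linearIndependent' ℚ (fun i => M.col (f i))
  have : Finite κ := hli.finite
  have := Fintype.ofFinite κ
  refine ⟨κ, this, a, ?_, fun i => ?_⟩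
  · rw [Matrix.rank_eq_finrank_span_cols, ← finrank_span_eq_card hli]
    refine Submodule.finrank_mono (Submodule.span_mono ?_)
    rintro _ ⟨j, rfl⟩
    exact ⟨f (a j), rfl⟩
  · exact hspan ▸ Submodule.subset_span ⟨i, rfl⟩

theorem exists_small_representative {m n : Type} [Fintype m] [Fintype n] (R : m → n → Prop)
    (d : ℕ) (X : Finset m) :
    ∃ Y : Finset m, (∀ v, min d (relCount R Y v) = min d (relCount R X v)) ∧
      Y.card ≤ d * (relMatrix R).rank := by
  obtain ⟨Y, hY, hmin⟩ := exists_minimal_of_wellFoundedLT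
    (fun Y : Finset m => ∀ v, min d (relCount R Y v) = min d (relCount R X v))
    ⟨X, fun _ => rfl⟩
  refine ⟨Y, hY, ?_⟩
  have hcrit : ∀ x ∈ Y, ∃ v, R x v ∧ relCount R Y v ≤ d := by
    intro x hx
    by_contra! h
    refine Finset.notMem_erase x Y (hmin (y := Y.erase x) (fun v => ?_) (Y.erase_subset x) hx)
    rw [← hY v]
    unfold relCount
    rw [Finset.filter_erase]
    by_cases hv : R x v
    · have h1 := h v hv
      unfold relCount at h1
      rw [Finset.card_erase_of_mem (by simp [hx, hv])]
      omega
    · rw [Finset.erase_eq_of_notMem (by simp [hv])]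
  obtain ⟨κ, _, a, hcard, hspan⟩ := exists_column_basis (relMatrix R)
    (fun v : {v : n // relCount R Y v ≤ d} => v.1)
  have hcover : Y ⊆ Finset.univ.biUnion fun j => Y.filter fun u => R u (a j).1 := by
    intro x hx
    by_contra hnot
    simp only [Finset.mem_biUnion, Finset.mem_univ, Finset.mem_filter, hx, true_and,
      not_exists] at hnot
    obtain ⟨v, hxv, hv⟩ := hcrit x hx
    have hle : Submodule.span ℚ (Set.range fun j => (relMatrix R).col (a j).1) ≤
        LinearMap.ker (LinearMap.proj x : (m → ℚ) →ₗ[ℚ] ℚ) := by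
      rw [Submodule.span_le]
      rintro _ ⟨j, rfl⟩
      simp [relMatrix, Matrix.col, hnot j]
    have := hle (hspan ⟨v, hv⟩)
    simp [relMatrix, Matrix.col, hxv] at this
  calc Y.card ≤ _ := Finset.card_le_card hcover
    _ ≤ Fintype.card κ * d := Finset.card_biUnion_le_card_mul _ _ _ fun j _ => (a j).2
    _ ≤ d * (relMatrix R).rank := by rw [mul_comm]; gcongr

theorem relCount_eq_of_basis {m n κ : Type} (R : m → n → Prop) (a : κ → n)
    (hspan : ∀ v, (relMatrix R).col v ∈
      Submodule.span ℚ (Set.range fun j => (relMatrix R).col (a j)))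
    {X Y : Finset m} (h : ∀ j, relCount R X (a j) = relCount R Y (a j)) (v : n) :
    relCount R X v = relCount R Y v := by
  have key (Z : Finset m) (w : n) :
      (∑ u ∈ Z, (LinearMap.proj u : (m → ℚ) →ₗ[ℚ] ℚ)) ((relMatrix R).col w) =
        relCount R Z w := by
    simp [relMatrix, Matrix.col, relCount]
  have hv := LinearMap.eqOn_span
    (f := ∑ u ∈ X, (LinearMap.proj u : (m → ℚ) →ₗ[ℚ] ℚ))
    (g := ∑ u ∈ Y, (LinearMap.proj u : (m → ℚ) →ₗ[ℚ] ℚ))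
    (by rintro _ ⟨j, rfl⟩; simp only [key, h]) (hspan v)
  simp only [key] at hv
  exact_mod_cast hv

theorem ncard_range_min_relCount_le {m n : Type} [Fintype m] [Fintype n] (R : m → n → Prop)
    (d : ℕ) :
    (Set.range fun (X : Finset m) (v : n) => min d (relCount R X v)).ncard ≤
      (d * (relMatrix R).rank + 1) ^ (relMatrix R).rank := by
  obtain ⟨κ, _, a, hcard, hspan⟩ := exists_column_basis (relMatrix R) (id : n → n)
  choose rep hrep hrepcard using exists_small_representative R d
  let code (X : Finset m) (j : κ) : Fin (d * (relMatrix R).rank + 1) :=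
    ⟨relCount R (rep X) (a j),
      Nat.lt_succ_of_le ((Finset.card_filter_le _ _).trans (hrepcard X))⟩
  have hcode (X Y : Finset m) (h : code X = code Y) :
      (fun v => min d (relCount R X v)) = fun v => min d (relCount R Y v) := by
    funext v
    rw [← hrep X v, ← hrep Y v,
      relCount_eq_of_basis R a hspan (fun j => congrArg Fin.val (congrFun h j)) v]
  choose pre hpre using fun p : Set.range fun (X : Finset m) (v : n) => min d (relCount R X v) =>
    p.2
  have hinj : Function.Injective fun p => code (pre p) := fun p q h =>
    Subtype.ext ((hpre p).symm.trans ((hcode _ _ h).trans (hpre q)))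
  calc _ ≤ Nat.card (κ → Fin (d * (relMatrix R).rank + 1)) :=
        Nat.card_le_card_of_injective _ hinj
    _ = (d * (relMatrix R).rank + 1) ^ Fintype.card κ := by simp
    _ ≤ _ := Nat.pow_le_pow_right (Nat.succ_pos _) hcard

theorem ncard_neighborSet_inter_eq_relCount {V : Type} [Fintype V] (G : SimpleGraph V)
    {A X : Set V} (hX : X ⊆ A) (v : ↥Aᶜ) :
    (G.neighborSet v ∩ X).ncard =
      relCount (fun (u : A) (v : ↥Aᶜ) => G.Adj u.1 v.1)
        (Finset.univ.filter fun u : A => u.1 ∈ X) v := by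
  unfold relCount
  rw [← Set.ncard_coe_finset, ← Set.ncard_image_of_injective _ Subtype.val_injective]
  congr 1
  ext w
  simp only [Set.mem_inter_iff, SimpleGraph.mem_neighborSet, Finset.coe_filter,
    Finset.mem_filter, Finset.mem_univ, true_and, Set.mem_image, Set.mem_ofPred_eq]
  constructor
  · rintro ⟨h, hw⟩
    exact ⟨⟨w, hX hw⟩, ⟨hw, h.symm⟩, rfl⟩
  · rintro ⟨u, ⟨hu, h⟩, rfl⟩
    exact ⟨h.symm, hu⟩

theorem stmt11 {V : Type} [Fintype V] (G : SimpleGraph V) (d : ℕ) (hd : 0 < d)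
    (A : Set V) (k : ℕ) (hk : k = cutRank ℚ G A) :
    nec G d A ≤ (d * k + 1) ^ k := by
  let R : A → ↥Aᶜ → Prop := fun u v => G.Adj u.1 v.1
  have hk' : k = (relMatrix R).rank := hk
  rw [hk']
  refine le_trans ?_ (ncard_range_min_relCount_le R d)
  let profile (X : Set V) (v : ↥Aᶜ) : ℕ :=
    min d (relCount R (Finset.univ.filter fun u : A => u.1 ∈ X) v)
  have hequiv {X Y : Set V} (hX : X ⊆ A) (hY : Y ⊆ A) :
      nEquiv G A d X Y ↔ profile X = profile Y := by
    rw [funext_iff, Subtype.forall]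
    refine forall₂_congr fun v hv => ?_
    rw [ncard_neighborSet_inter_eq_relCount G hX ⟨v, hv⟩,
      ncard_neighborSet_inter_eq_relCount G hY ⟨v, hv⟩]
  have hfin : (Set.range fun (X : Finset A) v => min d (relCount R X v)).Finite :=
    Set.finite_range _
  refine le_trans (Set.ncard_le_ncard ?_ (hfin.image fun p => {Y | Y ⊆ A ∧ p = profile Y}))
    (Set.ncard_image_le hfin)
  rintro _ ⟨X, hX, rfl⟩
  refine ⟨profile X, ⟨_, rfl⟩, ?_⟩
  ext Y
  exact and_congr_right fun hY => (hequiv hX hY).symm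
end

section
/- Let G be a finite simple graph with |V(G)| ≥ 2, let d be a positive integer, and let (T, δ) be a branch decomposition of V(G) whose cutrk^ℚ_G-width is k. Then for every cut (A, V(G)∖A) induced by an edge of T, both nec_d(A) ≤ (d·k + 1)^k and nec_d(V(G)∖A) ≤ (d·k + 1)^k; in particular the nec_d-width of (T, δ) is at most (d·k + 1)^k. -/
open scoped Classical

/-- The `nec_d`-width of a branch decomposition: the maximum over the cuts `(A, Aᶜ)`
induced by the edges of the tree of `max (nec G d A) (nec G d Aᶜ)`. -/
noncomputable def BranchDecomp.necWidth {V : Type} [Fintype V] (B : BranchDecomp V)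
    (G : SimpleGraph V) (d : ℕ) : ℕ :=
  sSup { n | ∃ u v : B.τ, B.T.Adj u v ∧
    max (nec G d (B.side u v)) (nec G d (B.side u v)ᶜ) = n }

/-- The `0/1` vector in `ℚ^A` of the neighbours in `A` of a vertex `v` outside `A`. -/
noncomputable def cutColumn {V : Type} (G : SimpleGraph V) (A : Set V) (v : ↥Aᶜ) : A → ℚ :=
  fun u => if G.Adj u.1 v.1 then 1 else 0

theorem cutRank_eq_finrank_span {V : Type} [Fintype V] (G : SimpleGraph V) (A : Set V) :
    cutRank ℚ G A = Module.finrank ℚ (Submodule.span ℚ (Set.range (cutColumn G A))) := by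
  unfold cutRank
  rw [Matrix.rank_eq_finrank_span_cols]
  rfl

theorem cutRank_compl {V : Type} [Fintype V] (G : SimpleGraph V) (A : Set V) :
    cutRank ℚ G Aᶜ = cutRank ℚ G A := by
  unfold cutRank
  rw [← Matrix.rank_transpose (Matrix.of fun (u : A) (v : ↥Aᶜ) => _),
    ← Matrix.rank_submatrix _ (Equiv.refl _) (Equiv.setCongr (compl_compl A))]
  convert rfl using 2
  ext u v
  simp [Matrix.submatrix, G.adj_comm]

theorem LinearIndependent.card_le_cutRank {V : Type} [Fintype V] {G : SimpleGraph V} {A : Set V}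
    {κ : Type} [Fintype κ] {a : κ → ↥Aᶜ} (h : LinearIndependent ℚ (cutColumn G A ∘ a)) :
    Fintype.card κ ≤ cutRank ℚ G A := by
  rw [← finrank_span_eq_card h, cutRank_eq_finrank_span]
  exact Submodule.finrank_mono (Submodule.span_mono (Set.range_comp_subset_range _ _))

/-- The linear functional on `ℚ^A` summing the coordinates in `X`. -/
noncomputable def sumOver {V : Type} [Fintype V] (A X : Set V) : (A → ℚ) →ₗ[ℚ] ℚ :=
  ∑ u : A, if u.1 ∈ X then LinearMap.proj u else 0

theorem sumOver_cutColumn {V : Type} [Fintype V] (G : SimpleGraph V) {A X : Set V}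
    (hX : X ⊆ A) (v : ↥Aᶜ) :
    sumOver A X (cutColumn G A v) = ((G.neighborSet v.1 ∩ X).ncard : ℚ) := by
  have h : G.neighborSet v.1 ∩ X = Subtype.val '' {u : A | u.1 ∈ X ∧ G.Adj u.1 v.1} := by
    ext w
    constructor
    · exact fun h => ⟨⟨w, hX h.2⟩, ⟨h.2, SimpleGraph.Adj.symm h.1⟩, rfl⟩
    · rintro ⟨u, hu, rfl⟩
      exact ⟨SimpleGraph.Adj.symm hu.2, hu.1⟩
  rw [h, Set.ncard_image_of_injective _ Subtype.val_injective, Set.ncard_eq_toFinset_card']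
  simp only [sumOver, LinearMap.sum_apply, Set.toFinset_ofPred, ← Finset.sum_boole]
  refine Finset.sum_congr rfl fun u _ => ?_
  by_cases hu : u.1 ∈ X <;> simp [hu, cutColumn]

theorem ncard_neighborSet_inter_eq {V : Type} [Fintype V] {G : SimpleGraph V} {A X Y : Set V}
    (hX : X ⊆ A) (hY : Y ⊆ A) {κ : Type} {a : κ → ↥Aᶜ}
    (ha : Submodule.span ℚ (Set.range (cutColumn G A ∘ a)) =
      Submodule.span ℚ (Set.range (cutColumn G A)))
    (h : ∀ i, (G.neighborSet (a i).1 ∩ X).ncard = (G.neighborSet (a i).1 ∩ Y).ncard)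
    (v : ↥Aᶜ) : (G.neighborSet v.1 ∩ X).ncard = (G.neighborSet v.1 ∩ Y).ncard := by
  have hEq : Set.EqOn (sumOver A X) (sumOver A Y) (Set.range (cutColumn G A ∘ a)) := by
    rintro _ ⟨i, rfl⟩
    simp [sumOver_cutColumn G hX, sumOver_cutColumn G hY, h]
  have hv : cutColumn G A v ∈ Submodule.span ℚ (Set.range (cutColumn G A ∘ a)) :=
    ha ▸ Submodule.subset_span ⟨v, rfl⟩
  have := LinearMap.eqOn_span hEq hv
  rw [sumOver_cutColumn G hX, sumOver_cutColumn G hY] at this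
  exact_mod_cast this

/-- A set each of whose elements has an outside neighbour seeing at most `d` elements of the set
has at most `d * cutRank` elements. -/
theorem ncard_le_mul_cutRank {V : Type} [Fintype V] {G : SimpleGraph V} {A X : Set V} {d : ℕ}
    (hX : X ⊆ A)
    (h : ∀ x ∈ X, ∃ v ∈ Aᶜ, G.Adj x v ∧ (G.neighborSet v ∩ X).ncard ≤ d) :
    X.ncard ≤ d * cutRank ℚ G A := by
  let S : Set ↥Aᶜ := {v | (G.neighborSet v.1 ∩ X).ncard ≤ d}
  obtain ⟨κ, a, ha, hspan, hli⟩ := exists_linearIndependent' ℚ (fun v : S => cutColumn G A v.1)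
  have : Finite κ := Finite.of_injective a ha
  have := Fintype.ofFinite κ
  have hcover : X ⊆ ⋃ i : κ, (G.neighborSet (a i).1.1 ∩ X) := by
    intro x hx
    by_contra hx'
    have hzero : Set.EqOn (LinearMap.proj (R := ℚ) (φ := fun _ : A => ℚ) ⟨x, hX hx⟩)
        (0 : (A → ℚ) →ₗ[ℚ] ℚ) (Set.range ((fun v : S => cutColumn G A v.1) ∘ a)) := by
      rintro _ ⟨i, rfl⟩
      have : ¬ G.Adj x (a i).1.1 := fun hadj => hx' (Set.mem_iUnion.2 ⟨i, hadj.symm, hx⟩)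
      simp [cutColumn, this]
    obtain ⟨v, hv, hadj, hcard⟩ := h x hx
    have hmem : cutColumn G A ⟨v, hv⟩ ∈
        Submodule.span ℚ (Set.range ((fun v : S => cutColumn G A v.1) ∘ a)) :=
      hspan ▸ Submodule.subset_span ⟨⟨⟨v, hv⟩, hcard⟩, rfl⟩
    have := LinearMap.eqOn_span hzero hmem
    simp [cutColumn, hadj] at this
  calc X.ncard ≤ (⋃ i : κ, (G.neighborSet (a i).1.1 ∩ X)).ncard :=
        Set.ncard_le_ncard hcover (Set.toFinite _)
    _ ≤ ∑ i : κ, (G.neighborSet (a i).1.1 ∩ X).ncard := by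
        simpa using Finset.set_ncard_biUnion_le Finset.univ
          fun i : κ => G.neighborSet (a i).1.1 ∩ X
    _ ≤ ∑ _i : κ, d := Finset.sum_le_sum fun i _ => (a i).2
    _ = d * Fintype.card κ := by simp [mul_comm]
    _ ≤ d * cutRank ℚ G A :=
        Nat.mul_le_mul_left d (LinearIndependent.card_le_cutRank (a := fun i => (a i).1) hli)

theorem exists_nEquiv_ncard_le {V : Type} [Fintype V] (G : SimpleGraph V) {A X : Set V} (d : ℕ)
    (hX : X ⊆ A) :
    ∃ Y ⊆ A, nEquiv G A d X Y ∧ Y.ncard ≤ d * cutRank ℚ G A := by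
  obtain ⟨Y, ⟨hYA, hXY⟩, hmin⟩ := Set.exists_min_image {Y | Y ⊆ A ∧ nEquiv G A d X Y} Set.ncard
    (Set.toFinite _) ⟨X, hX, fun _ _ => rfl⟩
  refine ⟨Y, hYA, hXY, ncard_le_mul_cutRank hYA fun x hx => ?_⟩
  by_contra! hlarge
  have hlt : (Y \ {x}).ncard < Y.ncard := Set.ncard_sdiff_singleton_lt_of_mem hx (Set.toFinite _)
  refine (hmin (Y \ {x}) ⟨Set.sdiff_subset.trans hYA, fun v hv => ?_⟩).not_gt hlt
  rw [hXY v hv]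
  by_cases hadj : G.Adj x v
  · have h₁ := hlarge v hv hadj
    have h₂ : (G.neighborSet v ∩ (Y \ {x})).ncard + 1 = (G.neighborSet v ∩ Y).ncard := by
      rw [← Set.inter_sdiff_assoc]
      exact Set.ncard_sdiff_singleton_add_one ⟨hadj.symm, hx⟩ (Set.toFinite _)
    omega
  · have : G.neighborSet v ∩ (Y \ {x}) = G.neighborSet v ∩ Y := by
      rw [← Set.inter_sdiff_assoc]
      exact Set.sdiff_singleton_eq_self fun h => hadj (SimpleGraph.Adj.symm h.1)
    rw [this]

theorem nec_le_cutRank {V : Type} [Fintype V] (G : SimpleGraph V) (d : ℕ) (A : Set V) :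
    nec G d A ≤ (d * cutRank ℚ G A + 1) ^ cutRank ℚ G A := by
  obtain ⟨κ, a, ha, hspan, hli⟩ := exists_linearIndependent' ℚ (cutColumn G A)
  have : Finite κ := Finite.of_injective a ha
  have := Fintype.ofFinite κ
  set r := cutRank ℚ G A
  choose! R hRA hR hRcard using fun (X : Set V) (hX : X ⊆ A) => exists_nEquiv_ncard_le G d hX
  let profile (X : Set V) : κ → Fin (d * r + 1) :=
    fun i => Fin.ofNat _ (G.neighborSet (a i).1 ∩ R X).ncard
  have hprofile : ∀ X ⊆ A, ∀ i, (profile X i : ℕ) = (G.neighborSet (a i).1 ∩ R X).ncard := by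
    intro X hX i
    exact Nat.mod_eq_of_lt (Nat.lt_succ_of_le
      ((Set.ncard_le_ncard Set.inter_subset_right (Set.toFinite _)).trans (hRcard X hX)))
  have hequiv : ∀ X ⊆ A, ∀ Y ⊆ A, profile X = profile Y → nEquiv G A d X Y := by
    intro X hX Y hY hXY v hv
    rw [hR X hX v hv, hR Y hY v hv]
    rw [ncard_neighborSet_inter_eq (hRA X hX) (hRA Y hY) hspan
      (fun i => by rw [← hprofile X hX, ← hprofile Y hY, hXY]) ⟨v, hv⟩]
  let cls (X : Set V) : Set (Set V) := {Y | Y ⊆ A ∧ nEquiv G A d X Y}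
  have hcls : ∀ X ⊆ A, ∀ Y ⊆ A, profile X = profile Y → cls X = cls Y := by
    intro X hX Y hY hXY
    have h := hequiv X hX Y hY hXY
    ext Z
    exact and_congr_right fun _ => forall₂_congr fun v hv => by rw [h v hv]
  choose! rep hrepA hrep using fun (C : Set (Set V)) (hC : ∃ X, X ⊆ A ∧ C = cls X) => hC
  calc nec G d A ≤ (Set.univ : Set (κ → Fin (d * r + 1))).ncard := by
        refine Set.ncard_le_ncard_of_injOn (profile ∘ rep) (fun _ _ => Set.mem_univ _) ?_
          (Set.toFinite _)
        intro C hC D hD hCD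
        rw [hrep C hC, hrep D hD]
        exact hcls _ (hrepA C hC) _ (hrepA D hD) hCD
    _ = (d * r + 1) ^ Fintype.card κ := by simp [Set.ncard_univ]
    _ ≤ (d * r + 1) ^ r := Nat.pow_le_pow_right (Nat.succ_pos _) hli.card_le_cutRank

theorem BranchDecomp.le_width_s12 {α : Type} [Fintype α] (B : BranchDecomp α) (f : Set α → ℕ)
    {u v : B.τ} (h : B.T.Adj u v) : f (B.side u v) ≤ B.width f := by
  refine le_csSup (Set.Finite.bddAbove ?_) ⟨u, v, h, rfl⟩
  refine (Set.finite_range fun p : B.τ × B.τ => f (B.side p.1 p.2)).subset ?_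
  rintro _ ⟨u, v, -, rfl⟩
  exact ⟨(u, v), rfl⟩

theorem stmt12 {V : Type} [Fintype V] (G : SimpleGraph V)
    (hV : 2 ≤ Fintype.card V) (d : ℕ) (hd : 0 < d)
    (B : BranchDecomp V) (k : ℕ) (hk : B.width (cutRank ℚ G) = k) :
    (∀ u v : B.τ, B.T.Adj u v →
        nec G d (B.side u v) ≤ (d * k + 1) ^ k ∧
        nec G d (B.side u v)ᶜ ≤ (d * k + 1) ^ k) ∧
      B.necWidth G d ≤ (d * k + 1) ^ k := by
  have hnec : ∀ A : Set V, cutRank ℚ G A ≤ k → nec G d A ≤ (d * k + 1) ^ k := fun A hA =>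
    (nec_le_cutRank G d A).trans <|
      (Nat.pow_le_pow_left (Nat.succ_le_succ (Nat.mul_le_mul_left d hA)) _).trans
        (Nat.pow_le_pow_right (Nat.succ_pos _) hA)
  have hcut : ∀ u v : B.τ, B.T.Adj u v →
      nec G d (B.side u v) ≤ (d * k + 1) ^ k ∧ nec G d (B.side u v)ᶜ ≤ (d * k + 1) ^ k := by
    intro u v huv
    have h : cutRank ℚ G (B.side u v) ≤ k := hk ▸ B.le_width_s12 (cutRank ℚ G) huv
    exact ⟨hnec _ h, hnec _ ((cutRank_compl G _).trans_le h)⟩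
  refine ⟨hcut, csSup_le' ?_⟩
  rintro _ ⟨u, v, huv, rfl⟩
  exact max_le (hcut u v huv).1 (hcut u v huv).2
end

section
/- Let M be an m × n matrix over ℚ all of whose entries are 0 or 1, let k be the rank of M over ℚ, and let N be a positive integer. Then the set of vectors in ℚ^n of the form ∑_{i ∈ S} (row i of M), where S ranges over subsets of the row index set with |S| ≤ N, has cardinality at most (N + 1)^k. -/
theorem stmt13 (m n : ℕ) (M : Matrix (Fin m) (Fin n) ℚ)
    (hM : ∀ i j, M i j = 0 ∨ M i j = 1)
    (k : ℕ) (hk : M.rank = k) (N : ℕ) (hN : 0 < N) :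
    Set.ncard { x : Fin n → ℚ |
        ∃ S : Finset (Fin m), S.card ≤ N ∧ x = ∑ i ∈ S, M i } ≤ (N + 1) ^ k := by
  classical
  have sum_apply (S : Finset (Fin m)) (j : Fin n) :
      (∑ i ∈ S, M i : Fin n → ℚ) j = ∑ i ∈ S, M i j := Finset.sum_apply j S M
  -- a family of columns forming a basis of the column space
  obtain ⟨κ, a, ha, hspan, hli⟩ := exists_linearIndependent' ℚ M.col
  have : Finite κ := Finite.of_injective a ha
  have : Fintype κ := Fintype.ofFinite κ
  have hcard : Fintype.card κ = k := by
    rw [← hk, Matrix.rank_eq_finrank_span_cols, ← hspan, finrank_span_eq_card hli]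
  let B : Finset (κ → ℚ) :=
    Fintype.piFinset fun _ => (Finset.range (N + 1)).image (Nat.cast : ℕ → ℚ)
  have hB : B.card = (N + 1) ^ k := by
    simp [B, Finset.card_image_of_injective _ (Nat.cast_injective (R := ℚ)), hcard]
  rw [← hB, ← Set.ncard_coe_finset]
  refine Set.ncard_le_ncard_of_injOn (fun x => x ∘ a) ?_ ?_ B.finite_toSet
  · rintro x ⟨S, hS, rfl⟩
    refine Finset.mem_coe.2 (Fintype.mem_piFinset.2 fun c => Finset.mem_image.2
      ⟨(S.filter fun i => M i (a c) = 1).card, ?_, ?_⟩)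
    · exact Finset.mem_range.2 (Nat.lt_succ_of_le ((Finset.card_filter_le _ _).trans hS))
    · rw [Function.comp_apply, sum_apply, Finset.card_filter]
      push_cast
      refine Finset.sum_congr rfl fun i _ => ?_
      rcases hM i (a c) with h | h <;> simp [h]
  · rintro x ⟨S, -, rfl⟩ y ⟨T, -, rfl⟩ hxy
    have key : Set.EqOn (∑ i ∈ S, LinearMap.proj i : (Fin m → ℚ) →ₗ[ℚ] ℚ)
        (∑ i ∈ T, LinearMap.proj i : (Fin m → ℚ) →ₗ[ℚ] ℚ)
        (Submodule.span ℚ (Set.range (M.col ∘ a))) := by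
      refine LinearMap.eqOn_span' ?_
      rintro _ ⟨c, rfl⟩
      have h := congrFun hxy c
      simp only [Function.comp_apply, sum_apply] at h
      simpa [Matrix.col_apply, Function.comp_apply] using h
    rw [hspan] at key
    ext j
    rw [sum_apply, sum_apply]
    simpa [Matrix.col] using key (Submodule.subset_span ⟨j, rfl⟩)
end
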